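/- Let ε ≥ 0 and let u be a smooth sphere-valued ε-harmonic map defined on an open neighbourhood of the closed unit disk in ℝ². Then for every t ∈ (0,1) the following Pohozaev-type identity holds: ∫_{∂B_t} (|∂_r u|² − t^{−2}|∂_θ u|²) dS = (2ε/t) ∫_{B_t} |Δu|² dx − 2ε ∫_{∂B_t} ( ½|Δu|² + ∑_{i=1}^{2} ⟨∂_i u, ∂_i Δu⟩ − 2⟨∂_r u, ∂_r(Δu)⟩ ) dS. -/

import Mathlib

open scoped RealInnerProductSpace
open Filter MeasureTheory Metric

noncomputable section

/-- The plane `ℝ²` as a Euclidean space. -/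
abbrev E2 : Type := EuclideanSpace ℝ (Fin 2)

/-- Euclidean space `ℝ^l`. -/
abbrev Eu (l : ℕ) : Type := EuclideanSpace ℝ (Fin l)

/-- Partial derivative `∂_α u` of a map `u : ℝ² → ℝ^l`. -/
def pd {l : ℕ} (α : Fin 2) (u : E2 → Eu l) (x : E2) : Eu l :=
  fderiv ℝ u x (EuclideanSpace.single α 1)

/-- Partial derivative `∂_α f` of a scalar function `f : ℝ² → ℝ`. -/
def pds (α : Fin 2) (f : E2 → ℝ) (x : E2) : ℝ :=
  fderiv ℝ f x (EuclideanSpace.single α 1)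

/-- The componentwise Laplacian `Δu = ∂₁∂₁u + ∂₂∂₂u`. -/
def lap {l : ℕ} (u : E2 → Eu l) (x : E2) : Eu l :=
  pd 0 (pd 0 u) x + pd 1 (pd 1 u) x

/-- `|∇u|² = |∂₁u|² + |∂₂u|²`. -/
def gradSq {l : ℕ} (u : E2 → Eu l) (x : E2) : ℝ :=
  ‖pd 0 u x‖ ^ 2 + ‖pd 1 u x‖ ^ 2

/-- The harmonic stress-energy tensor `S¹_{αβ}(u) = ½|∇u|²δ_{αβ} − ⟨∂_α u, ∂_β u⟩`. -/
def S1 {l : ℕ} (u : E2 → Eu l) (α β : Fin 2) (x : E2) : ℝ :=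
  (1 / 2) * gradSq u x * (if α = β then 1 else 0) - ⟪pd α u x, pd β u x⟫

/-- Jiang's biharmonic stress-energy tensor
`S²_{αβ}(u) = ½|Δu|²δ_{αβ} + ∑_γ ⟨∂_γ u, ∂_γ Δu⟩ δ_{αβ} − ⟨∂_α u, ∂_β Δu⟩ − ⟨∂_β u, ∂_α Δu⟩`. -/
def S2 {l : ℕ} (u : E2 → Eu l) (α β : Fin 2) (x : E2) : ℝ :=
  (1 / 2) * ‖lap u x‖ ^ 2 * (if α = β then 1 else 0)
    + (∑ γ : Fin 2, ⟪pd γ u x, pd γ (lap u) x⟫) * (if α = β then 1 else 0)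
    - ⟪pd α u x, pd β (lap u) x⟫ - ⟪pd β u x, pd α (lap u) x⟫

/-- A sphere-valued map `u : Ω → S^{l-1} ⊂ ℝ^l` is `ε`-harmonic if `Δu − εΔ²u` is a real
scalar multiple of `u` at every point of `Ω` (the Euler–Lagrange equation of the ε-energy). -/
def IsEpsHarmonic {l : ℕ} (ε : ℝ) (Ω : Set E2) (u : E2 → Eu l) : Prop :=
  ∀ x ∈ Ω, ∃ c : ℝ, lap u x - ε • lap (lap u) x = c • u x

/-- The point `(a, b) ∈ ℝ²`. -/
def pt (a b : ℝ) : E2 := (WithLp.equiv 2 (Fin 2 → ℝ)).symm ![a, b]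

/-- The radial derivative `∂_r u(x) = Du(x)[x/|x|]`. -/
def radialDeriv {l : ℕ} (u : E2 → Eu l) (x : E2) : Eu l :=
  fderiv ℝ u x (‖x‖⁻¹ • x)

/-- The angular derivative `∂_θ u(x) = Du(x)[(-x₂, x₁)]`, so that
`|∇u|² = |∂_r u|² + |x|⁻²|∂_θ u|²`. -/
def angularDeriv {l : ℕ} (u : E2 → Eu l) (x : E2) : Eu l :=
  fderiv ℝ u x (pt (-(x 1)) (x 0))

/-- The circle integral `∫_{∂B_t} f dS = ∫₀^{2π} f(t cos θ, t sin θ) t dθ`. -/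
def circInt (t : ℝ) (f : E2 → ℝ) : ℝ :=
  ∫ θ in (0:ℝ)..(2 * Real.pi), f (pt (t * Real.cos θ) (t * Real.sin θ)) * t

lemma pt_eq (a b : ℝ) :
    pt a b = a • EuclideanSpace.single (0 : Fin 2) (1 : ℝ) +
      b • EuclideanSpace.single (1 : Fin 2) (1 : ℝ) := by
  ext i
  fin_cases i <;> simp [pt]

lemma pt_coord_zero (a b : ℝ) : pt a b 0 = a := rfl

lemma pt_coord_one (a b : ℝ) : pt a b 1 = b := rfl

lemma fderiv_pt_eq_pd {l : ℕ} (u : E2 → Eu l) (x : E2) (a b : ℝ) :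
    fderiv ℝ u x (pt a b) = a • pd 0 u x + b • pd 1 u x := by
  simp [pt_eq, pd]

lemma fderiv_pt_eq_pds (f : E2 → ℝ) (x : E2) (a b : ℝ) :
    fderiv ℝ f x (pt a b) = a * pds 0 f x + b * pds 1 f x := by
  simp [pt_eq, pds]

lemma HasDerivAt.pt {a b : ℝ → ℝ} {a' b' s : ℝ} (ha : HasDerivAt a a' s)
    (hb : HasDerivAt b b' s) : HasDerivAt (fun r => pt (a r) (b r)) (pt a' b') s := by
  simp only [pt_eq]
  exact (ha.smul_const _).add (hb.smul_const _)

/-- The polar coordinate map into the plane. -/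
def polarPt (p : ℝ × ℝ) : E2 := pt (p.1 * Real.cos p.2) (p.1 * Real.sin p.2)

lemma contDiff_polarPt {n : WithTop ℕ∞} : ContDiff ℝ n polarPt := by
  unfold polarPt
  simp only [pt_eq]
  fun_prop

lemma norm_polarPt {p : ℝ × ℝ} (hp : 0 ≤ p.1) : ‖polarPt p‖ = p.1 := by
  rw [EuclideanSpace.norm_eq, Fin.sum_univ_two, polarPt, pt_coord_zero, pt_coord_one,
    Real.norm_eq_abs, Real.norm_eq_abs, sq_abs, sq_abs,
    show (p.1 * Real.cos p.2) ^ 2 + (p.1 * Real.sin p.2) ^ 2 = p.1 ^ 2 by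
      linear_combination p.1 ^ 2 * Real.cos_sq_add_sin_sq p.2, Real.sqrt_sq hp]

/-- `r` times the radial component of the field `(A, B)` in polar coordinates. -/
def polarRadial (A B : E2 → ℝ) (p : ℝ × ℝ) : ℝ :=
  p.1 * (Real.cos p.2 * A (polarPt p) + Real.sin p.2 * B (polarPt p))

/-- The angular component of the field `(A, B)` in polar coordinates. -/
def polarAngular (A B : E2 → ℝ) (p : ℝ × ℝ) : ℝ :=
  -Real.sin p.2 * A (polarPt p) + Real.cos p.2 * B (polarPt p)

lemma differentiableAt_polarRadial {A B : E2 → ℝ} {p : ℝ × ℝ}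
    (hA : DifferentiableAt ℝ A (polarPt p)) (hB : DifferentiableAt ℝ B (polarPt p)) :
    DifferentiableAt ℝ (polarRadial A B) p := by
  have hP : DifferentiableAt ℝ polarPt p :=
    (contDiff_polarPt (n := 1)).differentiable (by simp) p
  have hA' : DifferentiableAt ℝ (fun q => A (polarPt q)) p := hA.comp p hP
  have hB' : DifferentiableAt ℝ (fun q => B (polarPt q)) p := hB.comp p hP
  unfold polarRadial
  fun_prop

lemma differentiableAt_polarAngular {A B : E2 → ℝ} {p : ℝ × ℝ}
    (hA : DifferentiableAt ℝ A (polarPt p)) (hB : DifferentiableAt ℝ B (polarPt p)) :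
    DifferentiableAt ℝ (polarAngular A B) p := by
  have hP : DifferentiableAt ℝ polarPt p :=
    (contDiff_polarPt (n := 1)).differentiable (by simp) p
  have hA' : DifferentiableAt ℝ (fun q => A (polarPt q)) p := hA.comp p hP
  have hB' : DifferentiableAt ℝ (fun q => B (polarPt q)) p := hB.comp p hP
  unfold polarAngular
  fun_prop

lemma polar_divergence {A B : E2 → ℝ} {p : ℝ × ℝ}
    (hA : DifferentiableAt ℝ A (polarPt p)) (hB : DifferentiableAt ℝ B (polarPt p)) :
    fderiv ℝ (polarRadial A B) p (1, 0) + fderiv ℝ (polarAngular A B) p (0, 1) =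
      p.1 * (pds 0 A (polarPt p) + pds 1 B (polarPt p)) := by
  obtain ⟨r, θ⟩ := p
  have hr : HasDerivAt (fun s => polarPt (s, θ)) (pt (Real.cos θ) (Real.sin θ)) r := by
    have h := HasDerivAt.pt ((hasDerivAt_id r).mul_const (Real.cos θ))
      ((hasDerivAt_id r).mul_const (Real.sin θ))
    simpa [polarPt] using h
  have hθ : HasDerivAt (fun s => polarPt (r, s))
      (pt (r * -Real.sin θ) (r * Real.cos θ)) θ :=
    HasDerivAt.pt ((Real.hasDerivAt_cos θ).const_mul r) ((Real.hasDerivAt_sin θ).const_mul r)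
  have key : ∀ {C : E2 → ℝ}, DifferentiableAt ℝ C (polarPt (r, θ)) →
      HasDerivAt (fun s => C (polarPt (s, θ))) (Real.cos θ * pds 0 C (polarPt (r, θ)) +
        Real.sin θ * pds 1 C (polarPt (r, θ))) r ∧
      HasDerivAt (fun s => C (polarPt (r, s))) (r * -Real.sin θ * pds 0 C (polarPt (r, θ)) +
        r * Real.cos θ * pds 1 C (polarPt (r, θ))) θ := by
    intro C hC
    rw [← fderiv_pt_eq_pds, ← fderiv_pt_eq_pds]
    exact ⟨hC.hasFDerivAt.comp_hasDerivAt r hr, hC.hasFDerivAt.comp_hasDerivAt θ hθ⟩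
  have h1 : HasDerivAt (fun s => polarRadial A B (s, θ)) _ r :=
    (hasDerivAt_id r).mul (((key hA).1.const_mul (Real.cos θ)).add
      ((key hB).1.const_mul (Real.sin θ)))
  have h2 : HasDerivAt (fun s => polarAngular A B (r, s)) _ θ :=
    ((Real.hasDerivAt_sin θ).neg.mul (key hA).2).add
      ((Real.hasDerivAt_cos θ).mul (key hB).2)
  have h1' : HasDerivAt (fun s => polarRadial A B (s, θ)) _ r :=
    (differentiableAt_polarRadial hA hB).hasFDerivAt.comp_hasDerivAt
      (f := fun s => (s, θ)) r
      ((hasDerivAt_id r).prodMk (hasDerivAt_const r θ))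
  have h2' : HasDerivAt (fun s => polarAngular A B (r, s)) _ θ :=
    (differentiableAt_polarAngular hA hB).hasFDerivAt.comp_hasDerivAt
      (f := fun s => (r, s)) θ
      ((hasDerivAt_const θ r).prodMk (hasDerivAt_id θ))
  rw [h1'.unique h1, h2'.unique h2]
  simp only [id, Pi.neg_apply]
  linear_combination r * (pds 0 A (polarPt (r, θ)) + pds 1 B (polarPt (r, θ))) *
    Real.cos_sq_add_sin_sq θ

lemma continuousOn_divergence {A B : E2 → ℝ} {Ω : Set E2} (hΩ : IsOpen Ω)
    (hA : ContDiffOn ℝ 1 A Ω) (hB : ContDiffOn ℝ 1 B Ω) :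
    ContinuousOn (fun x => pds 0 A x + pds 1 B x) Ω :=
  ((hA.continuousOn_fderiv_of_isOpen hΩ le_rfl).clm_apply continuousOn_const).add
    ((hB.continuousOn_fderiv_of_isOpen hΩ le_rfl).clm_apply continuousOn_const)

lemma setIntegral_ball_eq_polar (f : E2 → ℝ) {t : ℝ} :
    ∫ x in ball (0 : E2) t, f x =
      ∫ p in Set.Ioo (0 : ℝ) t ×ˢ Set.Ioo (-Real.pi) Real.pi, p.1 * f (polarPt p) := by
  have hm := (PiLp.volume_preserving_toLp (Fin 2)).comp
    ((volume_preserving_finTwoArrow ℝ).symm)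
  have he : MeasurableEmbedding
      (WithLp.toLp 2 ∘ (MeasurableEquiv.finTwoArrow (α := ℝ)).symm : ℝ × ℝ → E2) :=
    (MeasurableEquiv.toLp 2 (Fin 2 → ℝ)).measurableEmbedding.comp
      (MeasurableEquiv.finTwoArrow (α := ℝ)).symm.measurableEmbedding
  rw [← integral_indicator measurableSet_ball, ← hm.integral_comp he,
    ← integral_comp_polarCoord_symm, polarCoord_target]
  have hP : ∀ p : ℝ × ℝ, (WithLp.toLp 2 ∘ (MeasurableEquiv.finTwoArrow (α := ℝ)).symm)
      (polarCoord.symm p) = polarPt p := by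
    intro p
    ext i
    fin_cases i <;> simp [polarPt, pt]
  simp only [hP]
  have hsub : Set.Ioo (0 : ℝ) t ×ˢ Set.Ioo (-Real.pi) Real.pi ⊆
      Set.Ioi (0 : ℝ) ×ˢ Set.Ioo (-Real.pi) Real.pi :=
    Set.prod_mono_left fun x hx => hx.1
  rw [setIntegral_eq_of_subset_of_forall_sdiff_eq_zero
    (measurableSet_Ioi.prod measurableSet_Ioo) hsub]
  · refine setIntegral_congr_fun (measurableSet_Ioo.prod measurableSet_Ioo) fun p hp => ?_
    have : polarPt p ∈ ball (0 : E2) t := by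
      rw [mem_ball_zero_iff, norm_polarPt hp.1.1.le]
      exact hp.1.2
    simp [this]
  · intro p hp
    have : polarPt p ∉ ball (0 : E2) t := by
      rw [mem_ball_zero_iff, norm_polarPt (le_of_lt hp.1.1)]
      exact fun h => hp.2 ⟨⟨hp.1.1, h⟩, hp.1.2⟩
    simp [this]

/-- The divergence theorem on a disk centred at the origin. -/
lemma integral_ball_divergence {A B : E2 → ℝ} {Ω : Set E2} (hΩ : IsOpen Ω) {t : ℝ}
    (ht : 0 < t) (hsub : closedBall (0 : E2) t ⊆ Ω)
    (hA : ContDiffOn ℝ 1 A Ω) (hB : ContDiffOn ℝ 1 B Ω) :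
    ∫ x in ball (0 : E2) t, (pds 0 A x + pds 1 B x) =
      circInt t (fun x => (x 0 * A x + x 1 * B x) / t) := by
  have hpi : -Real.pi ≤ Real.pi := by linarith [Real.pi_pos]
  have hmem : ∀ p ∈ Set.Icc ((0 : ℝ), -Real.pi) (t, Real.pi), polarPt p ∈ Ω := by
    intro p hp
    apply hsub
    rw [mem_closedBall_zero_iff, norm_polarPt hp.1.1]
    exact hp.2.1
  have hdA : ∀ p ∈ Set.Icc ((0 : ℝ), -Real.pi) (t, Real.pi),
      DifferentiableAt ℝ A (polarPt p) := fun p hp =>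
    (hA.contDiffAt (hΩ.mem_nhds (hmem p hp))).differentiableAt (by simp)
  have hdB : ∀ p ∈ Set.Icc ((0 : ℝ), -Real.pi) (t, Real.pi),
      DifferentiableAt ℝ B (polarPt p) := fun p hp =>
    (hB.contDiffAt (hΩ.mem_nhds (hmem p hp))).differentiableAt (by simp)
  have hIoo : ∀ p ∈ Set.Ioo (0 : ℝ) t ×ˢ Set.Ioo (-Real.pi) Real.pi,
      p ∈ Set.Icc ((0 : ℝ), -Real.pi) (t, Real.pi) := fun p hp =>
    ⟨⟨hp.1.1.le, hp.2.1.le⟩, ⟨hp.1.2.le, hp.2.2.le⟩⟩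
  have hdiv := fun p hp => polar_divergence (hdA p hp) (hdB p hp)
  have hint : IntegrableOn (fun p => fderiv ℝ (polarRadial A B) p (1, 0) +
      fderiv ℝ (polarAngular A B) p (0, 1)) (Set.Icc ((0 : ℝ), -Real.pi) (t, Real.pi)) := by
    refine ContinuousOn.integrableOn_compact isCompact_Icc ?_
    refine ContinuousOn.congr ?_ hdiv
    exact continuousOn_fst.mul ((continuousOn_divergence hΩ hA hB).comp
      (contDiff_polarPt (n := 0)).continuous.continuousOn hmem)
  have h := integral_divergence_prod_Icc_of_hasFDerivAt_of_le
    (polarRadial A B) (polarAngular A B) (fderiv ℝ (polarRadial A B))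
    (fderiv ℝ (polarAngular A B)) (0, -Real.pi) (t, Real.pi) ⟨ht.le, hpi⟩
    (fun p hp => (differentiableAt_polarRadial
      (hdA p hp) (hdB p hp)).continuousAt.continuousWithinAt)
    (fun p hp => (differentiableAt_polarAngular
      (hdA p hp) (hdB p hp)).continuousAt.continuousWithinAt)
    (fun p hp => (differentiableAt_polarRadial
      (hdA p (hIoo p hp)) (hdB p (hIoo p hp))).hasFDerivAt)
    (fun p hp => (differentiableAt_polarAngular
      (hdA p (hIoo p hp)) (hdB p (hIoo p hp))).hasFDerivAt) hint
  rw [setIntegral_congr_fun measurableSet_Icc hdiv, ← Set.Icc_prod_Icc,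
    Measure.volume_eq_prod,
    ← setIntegral_congr_set (Measure.set_prod_ae_eq Ioo_ae_eq_Icc Ioo_ae_eq_Icc),
    ← Measure.volume_eq_prod] at h
  rw [setIntegral_ball_eq_polar, h]
  have h0 : ∀ y, polarRadial A B (0, y) = 0 := fun y => by simp [polarRadial]
  have hpm : ∀ x, polarAngular A B (x, Real.pi) = polarAngular A B (x, -Real.pi) := fun x => by
    simp [polarAngular, polarPt]
  have hper : Function.Periodic (fun y => polarRadial A B (t, y)) (2 * Real.pi) := fun y => by
    simp [polarRadial, polarPt]
  have hshift := hper.intervalIntegral_add_eq (-Real.pi) 0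
  rw [show -Real.pi + 2 * Real.pi = Real.pi by ring, zero_add] at hshift
  simp only [h0, hpm, sub_self, intervalIntegral.integral_zero, sub_zero, zero_add]
  rw [hshift]
  unfold circInt
  refine intervalIntegral.integral_congr fun θ _ => ?_
  simp only [polarRadial, polarPt, pt_coord_zero, pt_coord_one]
  field_simp

lemma ContDiffOn.pd_infty {l : ℕ} {Ω : Set E2} (hΩ : IsOpen Ω) {u : E2 → Eu l}
    (hu : ContDiffOn ℝ (⊤ : ℕ∞) u Ω) (α : Fin 2) : ContDiffOn ℝ (⊤ : ℕ∞) (pd α u) Ω :=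
  (hu.fderiv_of_isOpen hΩ (by simp)).clm_apply contDiffOn_const

lemma ContDiffOn.lap_infty {l : ℕ} {Ω : Set E2} (hΩ : IsOpen Ω) {u : E2 → Eu l}
    (hu : ContDiffOn ℝ (⊤ : ℕ∞) u Ω) : ContDiffOn ℝ (⊤ : ℕ∞) (lap u) Ω :=
  ((hu.pd_infty hΩ 0).pd_infty hΩ 0).add ((hu.pd_infty hΩ 1).pd_infty hΩ 1)

lemma pd_comm {l : ℕ} {Ω : Set E2} (hΩ : IsOpen Ω) {u : E2 → Eu l}
    (hu : ContDiffOn ℝ (⊤ : ℕ∞) u Ω) {x : E2} (hx : x ∈ Ω) (α β : Fin 2) :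
    pd α (pd β u) x = pd β (pd α u) x := by
  have hd : DifferentiableAt ℝ (fderiv ℝ u) x :=
    ((hu.fderiv_of_isOpen (m := 1) hΩ (by norm_cast)).contDiffAt
      (hΩ.mem_nhds hx)).differentiableAt (by simp)
  have key : ∀ γ δ : Fin 2, pd γ (pd δ u) x =
      fderiv ℝ (fderiv ℝ u) x (EuclideanSpace.single γ 1) (EuclideanSpace.single δ 1) := by
    intro γ δ
    have h := hd.hasFDerivAt.clm_apply
      (hasFDerivAt_const (EuclideanSpace.single δ (1 : ℝ) : E2) x)
    change fderiv ℝ (fun y => fderiv ℝ u y (EuclideanSpace.single δ 1)) x _ = _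
    rw [h.fderiv]
    simp
  rw [key, key]
  exact ((hu.contDiffAt (hΩ.mem_nhds hx)).isSymmSndFDerivAt
    (by simp only [minSmoothness_of_isRCLikeNormedField]; norm_cast)) _ _

lemma ContDiffOn.hasDerivAt_pd {l : ℕ} {Ω : Set E2} (hΩ : IsOpen Ω) {u : E2 → Eu l}
    (hu : ContDiffOn ℝ (⊤ : ℕ∞) u Ω) {x : E2} (hx : x ∈ Ω) (α : Fin 2) :
    HasDerivAt (fun s : ℝ => u (x + s • EuclideanSpace.single α (1 : ℝ))) (pd α u x) 0 :=
  (((hu.contDiffAt (hΩ.mem_nhds hx)).differentiableAt (by simp)).hasFDerivAt.hasLineDerivAt _)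

lemma pds_eq_of_hasDerivAt {f : E2 → ℝ} {x : E2} {α : Fin 2} {c : ℝ}
    (hf : DifferentiableAt ℝ f x)
    (h : HasDerivAt (fun s : ℝ => f (x + s • EuclideanSpace.single α (1 : ℝ))) c 0) :
    pds α f x = c :=
  (hf.hasFDerivAt.hasLineDerivAt _).unique h

/-- The diagonal part `½(|∂₂u|² − |∂₁u|²) − ε(⟨∂₂u, ∂₂Δu⟩ − ⟨∂₁u, ∂₁Δu⟩)` of the trace-free
stress-energy tensor. -/
def stressP {l : ℕ} (ε : ℝ) (u : E2 → Eu l) (x : E2) : ℝ :=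
  (1 / 2) * (⟪pd 1 u x, pd 1 u x⟫ - ⟪pd 0 u x, pd 0 u x⟫)
    - ε * (⟪pd 1 u x, pd 1 (lap u) x⟫ - ⟪pd 0 u x, pd 0 (lap u) x⟫)

/-- The off-diagonal part `−⟨∂₁u, ∂₂u⟩ + ε(⟨∂₁u, ∂₂Δu⟩ + ⟨∂₂u, ∂₁Δu⟩)` of the stress-energy
tensor. -/
def stressQ {l : ℕ} (ε : ℝ) (u : E2 → Eu l) (x : E2) : ℝ :=
  -⟪pd 0 u x, pd 1 u x⟫ + ε * (⟪pd 0 u x, pd 1 (lap u) x⟫ + ⟪pd 1 u x, pd 0 (lap u) x⟫)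

/-- The trace part `(ε/2)|Δu|²` of the stress-energy tensor. -/
def stressR {l : ℕ} (ε : ℝ) (u : E2 → Eu l) (x : E2) : ℝ :=
  ε / 2 * ⟪lap u x, lap u x⟫

/-- First component of the stress-energy tensor contracted with the position field. -/
def stressA {l : ℕ} (ε : ℝ) (u : E2 → Eu l) (x : E2) : ℝ :=
  (stressP ε u x - stressR ε u x) * x 0 + stressQ ε u x * x 1

/-- Second component of the stress-energy tensor contracted with the position field. -/
def stressB {l : ℕ} (ε : ℝ) (u : E2 → Eu l) (x : E2) : ℝ :=
  stressQ ε u x * x 0 + (-stressP ε u x - stressR ε u x) * x 1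

section Stress

variable {l : ℕ} {Ω : Set E2} {u : E2 → Eu l}

lemma contDiffOn_stressP (hΩ : IsOpen Ω) (hu : ContDiffOn ℝ (⊤ : ℕ∞) u Ω) (ε : ℝ) :
    ContDiffOn ℝ (⊤ : ℕ∞) (stressP ε u) Ω := by
  have h := hu.pd_infty hΩ
  have h' := (hu.lap_infty hΩ).pd_infty hΩ
  exact (contDiffOn_const.mul (((h 1).inner ℝ (h 1)).sub ((h 0).inner ℝ (h 0)))).sub
    (contDiffOn_const.mul (((h 1).inner ℝ (h' 1)).sub ((h 0).inner ℝ (h' 0))))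

lemma contDiffOn_stressQ (hΩ : IsOpen Ω) (hu : ContDiffOn ℝ (⊤ : ℕ∞) u Ω) (ε : ℝ) :
    ContDiffOn ℝ (⊤ : ℕ∞) (stressQ ε u) Ω := by
  have h := hu.pd_infty hΩ
  have h' := (hu.lap_infty hΩ).pd_infty hΩ
  exact ((h 0).inner ℝ (h 1)).neg.add
    (contDiffOn_const.mul (((h 0).inner ℝ (h' 1)).add ((h 1).inner ℝ (h' 0))))

lemma contDiffOn_stressR (hΩ : IsOpen Ω) (hu : ContDiffOn ℝ (⊤ : ℕ∞) u Ω) (ε : ℝ) :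
    ContDiffOn ℝ (⊤ : ℕ∞) (stressR ε u) Ω :=
  contDiffOn_const.mul ((hu.lap_infty hΩ).inner ℝ (hu.lap_infty hΩ))

lemma contDiffOn_coord (i : Fin 2) : ContDiffOn ℝ (⊤ : ℕ∞) (fun x : E2 => x i) Ω :=
  (EuclideanSpace.proj (𝕜 := ℝ) i).contDiff.contDiffOn

lemma contDiffOn_stressA (hΩ : IsOpen Ω) (hu : ContDiffOn ℝ (⊤ : ℕ∞) u Ω) (ε : ℝ) :
    ContDiffOn ℝ (⊤ : ℕ∞) (stressA ε u) Ω :=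
  (((contDiffOn_stressP hΩ hu ε).sub (contDiffOn_stressR hΩ hu ε)).mul (contDiffOn_coord 0)).add
    ((contDiffOn_stressQ hΩ hu ε).mul (contDiffOn_coord 1))

lemma contDiffOn_stressB (hΩ : IsOpen Ω) (hu : ContDiffOn ℝ (⊤ : ℕ∞) u Ω) (ε : ℝ) :
    ContDiffOn ℝ (⊤ : ℕ∞) (stressB ε u) Ω :=
  ((contDiffOn_stressQ hΩ hu ε).mul (contDiffOn_coord 0)).add
    (((contDiffOn_stressP hΩ hu ε).neg.sub (contDiffOn_stressR hΩ hu ε)).mul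
      (contDiffOn_coord 1))

/-- Since `u` is sphere-valued, its derivatives are orthogonal to `u`, hence to `Δu − εΔ²u`. -/
lemma inner_pd_lap_eq (hΩ : IsOpen Ω) (hu : ContDiffOn ℝ (⊤ : ℕ∞) u Ω) {ε : ℝ}
    (hsph : ∀ x ∈ Ω, ‖u x‖ = 1) (hharm : IsEpsHarmonic ε Ω u) {x : E2} (hx : x ∈ Ω)
    (α : Fin 2) : ⟪pd α u x, lap u x⟫ = ε * ⟪pd α u x, lap (lap u) x⟫ := by
  have hc : HasDerivAt (fun s : ℝ => ⟪u (x + s • EuclideanSpace.single α (1 : ℝ)),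
      u (x + s • EuclideanSpace.single α (1 : ℝ))⟫) 0 0 := by
    refine (hasDerivAt_const (0 : ℝ) (1 : ℝ)).congr_of_eventuallyEq ?_
    have hcont : ContinuousAt
        (fun s : ℝ => x + s • (EuclideanSpace.single α (1 : ℝ) : E2)) 0 := by fun_prop
    have hev := hcont.eventually_mem (s := Ω) (by simpa using hΩ.mem_nhds hx)
    filter_upwards [hev] with s hs
    rw [real_inner_self_eq_norm_sq, hsph _ hs, one_pow]
  have h1 := (hu.hasDerivAt_pd hΩ hx α).inner ℝ (hu.hasDerivAt_pd hΩ hx α)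
  have h0 := h1.unique hc
  simp only [zero_smul, add_zero] at h0
  rw [real_inner_comm] at h0
  obtain ⟨c, hc'⟩ := hharm x hx
  have h2 : ⟪pd α u x, lap u x - ε • lap (lap u) x⟫ = 0 := by
    rw [hc', inner_smul_right]
    linear_combination c / 2 * h0
  rw [inner_sub_right, inner_smul_right] at h2
  linarith

lemma stress_divergence (hΩ : IsOpen Ω) (hu : ContDiffOn ℝ (⊤ : ℕ∞) u Ω) {ε : ℝ}
    (hsph : ∀ x ∈ Ω, ‖u x‖ = 1) (hharm : IsEpsHarmonic ε Ω u) {x : E2} (hx : x ∈ Ω) :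
    pds 0 (stressA ε u) x + pds 1 (stressB ε u) x = -ε * ‖lap u x‖ ^ 2 := by
  have hv := hu.lap_infty hΩ
  have dv := fun α => hv.hasDerivAt_pd hΩ hx α
  have da := fun γ α => (hu.pd_infty hΩ γ).hasDerivAt_pd hΩ hx α
  have db := fun γ α => (hv.pd_infty hΩ γ).hasDerivAt_pd hΩ hx α
  have dP := fun α => (((da 1 α).inner ℝ (da 1 α)).sub ((da 0 α).inner ℝ (da 0 α))).const_mul
    (1 / 2 : ℝ) |>.sub
      ((((da 1 α).inner ℝ (db 1 α)).sub ((da 0 α).inner ℝ (db 0 α))).const_mul ε)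
  have dQ := fun α => ((da 0 α).inner ℝ (da 1 α)).neg.add
      ((((da 0 α).inner ℝ (db 1 α)).add ((da 1 α).inner ℝ (db 0 α))).const_mul ε)
  have dR := fun α => ((dv α).inner ℝ (dv α)).const_mul (ε / 2)
  have dx : ∀ i α : Fin 2, HasDerivAt
      (fun s : ℝ => (x + s • (EuclideanSpace.single α (1 : ℝ) : E2)) i)
      ((EuclideanSpace.single α (1 : ℝ) : E2) i) 0 := fun i α =>
    (EuclideanSpace.proj (𝕜 := ℝ) i).hasFDerivAt.hasLineDerivAt _
  rw [pds_eq_of_hasDerivAt (((contDiffOn_stressA hΩ hu ε).contDiffAt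
      (hΩ.mem_nhds hx)).differentiableAt (by simp))
      ((((dP 0).sub (dR 0)).mul (dx 0 0)).add ((dQ 0).mul (dx 1 0))),
    pds_eq_of_hasDerivAt (((contDiffOn_stressB hΩ hu ε).contDiffAt
      (hΩ.mem_nhds hx)).differentiableAt (by simp))
      (((dQ 1).mul (dx 0 1)).add (((dP 1).neg.sub (dR 1)).mul (dx 1 1)))]
  have e0 := inner_pd_lap_eq hΩ hu hsph hharm hx 0
  have e1 := inner_pd_lap_eq hΩ hu hsph hharm hx 1
  have hlap : ∀ w : E2 → Eu l, lap w x = pd 0 (pd 0 w) x + pd 1 (pd 1 w) x := fun w => rfl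
  rw [hlap (lap u), inner_add_right] at e0 e1
  have el : ∀ α, ⟪pd α u x, lap u x⟫ =
      ⟪pd α u x, pd 0 (pd 0 u) x⟫ + ⟪pd α u x, pd 1 (pd 1 u) x⟫ := fun α => by
    rw [hlap u, inner_add_right]
  have er : ∀ w : Eu l, ⟪lap u x, w⟫ =
      ⟪pd 0 (pd 0 u) x, w⟫ + ⟪pd 1 (pd 1 u) x, w⟫ := fun w => by
    rw [hlap u, inner_add_left]
  have r0 := er (pd 0 (lap u) x)
  have r1 := er (pd 1 (lap u) x)
  rw [el] at e0 e1
  simp only [Pi.sub_apply, Pi.add_apply, Pi.neg_apply, zero_smul, add_zero,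
    pd_comm hΩ hu hx 1 0, pd_comm hΩ hv hx 1 0,
    real_inner_comm (pd 0 u x) (pd 0 (pd 0 u) x), real_inner_comm (pd 1 u x) (pd 0 (pd 1 u) x),
    real_inner_comm (pd 1 u x) (pd 1 (pd 1 u) x), real_inner_comm (pd 0 u x) (pd 0 (pd 1 u) x),
    real_inner_comm (pd 1 u x) (pd 0 (pd 0 u) x),
    real_inner_comm (lap u x) (pd 0 (lap u) x), real_inner_comm (lap u x) (pd 1 (lap u) x)]
  simp only [real_inner_self_eq_norm_sq, PiLp.single_apply, if_true, one_ne_zero, zero_ne_one,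
    if_false]
  linear_combination -x 0 * e0 - x 1 * e1 - ε * x 0 * r0 - ε * x 1 * r1

end Stress

lemma radialDeriv_polarPt {l : ℕ} (w : E2 → Eu l) {t : ℝ} (ht : 0 < t) (θ : ℝ) :
    radialDeriv w (polarPt (t, θ)) =
      Real.cos θ • pd 0 w (polarPt (t, θ)) + Real.sin θ • pd 1 w (polarPt (t, θ)) := by
  rw [radialDeriv, norm_polarPt ht.le, ← fderiv_pt_eq_pd]
  congr 1
  ext i
  fin_cases i <;> simp [polarPt, pt, ht.ne']

lemma angularDeriv_polarPt {l : ℕ} (w : E2 → Eu l) (t θ : ℝ) :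
    angularDeriv w (polarPt (t, θ)) =
      (-(t * Real.sin θ)) • pd 0 w (polarPt (t, θ)) +
        (t * Real.cos θ) • pd 1 w (polarPt (t, θ)) := by
  rw [angularDeriv, fderiv_pt_eq_pd]
  rfl

lemma stress_normal {l : ℕ} (ε : ℝ) (u : E2 → Eu l) {t : ℝ} (ht : 0 < t) {θ : ℝ} {x : E2}
    (hx : x = polarPt (t, θ)) :
    (x 0 * stressA ε u x + x 1 * stressB ε u x) / t =
      -(t / 2) * ((‖radialDeriv u x‖ ^ 2 - t⁻¹ ^ 2 * ‖angularDeriv u x‖ ^ 2) +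
        2 * ε * ((1 / 2) * ‖lap u x‖ ^ 2 + (∑ i : Fin 2, ⟪pd i u x, pd i (lap u) x⟫)
          - 2 * ⟪radialDeriv u x, radialDeriv (lap u) x⟫)) := by
  subst hx
  have h0 : polarPt (t, θ) 0 = t * Real.cos θ := rfl
  have h1 : polarPt (t, θ) 1 = t * Real.sin θ := rfl
  rw [radialDeriv_polarPt u ht, radialDeriv_polarPt (lap u) ht, angularDeriv_polarPt, stressA,
    stressB, stressP, stressQ, stressR, h0, h1, Fin.sum_univ_two]
  generalize polarPt (t, θ) = x
  simp only [← real_inner_self_eq_norm_sq, inner_add_left, inner_add_right,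
    real_inner_smul_left, real_inner_smul_right]
  rw [real_inner_comm (pd 0 u x) (pd 1 u x)]
  field_simp
  linear_combination -ε * (⟪lap u x, lap u x⟫ +
    2 * (⟪pd 0 u x, pd 0 (lap u) x⟫ + ⟪pd 1 u x, pd 1 (lap u) x⟫)) *
    Real.cos_sq_add_sin_sq θ

lemma continuous_comp_polarPt {F : Type*} [TopologicalSpace F] {Ω : Set E2} {t : ℝ}
    (ht : 0 ≤ t) (hsub : closedBall (0 : E2) t ⊆ Ω) {f : E2 → F} (hf : ContinuousOn f Ω) :
    Continuous fun θ : ℝ => f (polarPt (t, θ)) := by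
  refine hf.comp_continuous ((contDiff_polarPt (n := 0)).continuous.comp
    (by fun_prop : Continuous fun θ : ℝ => (t, θ))) fun θ => hsub ?_
  simp [norm_polarPt, ht]

lemma circInt_eq_polarPt (t : ℝ) (f : E2 → ℝ) :
    circInt t f = ∫ θ in (0 : ℝ)..(2 * Real.pi), f (polarPt (t, θ)) * t := rfl

/-- Pohozaev-type identity for a smooth sphere-valued `ε`-harmonic map (`ε ≥ 0`)
on a neighbourhood of the closed unit disk: for every `t ∈ (0,1)`,
`∫_{∂B_t} (|∂_r u|² − t⁻²|∂_θ u|²) dS = (2ε/t) ∫_{B_t} |Δu|² dx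
  − 2ε ∫_{∂B_t} (½|Δu|² + ∑_i ⟨∂_i u, ∂_i Δu⟩ − 2⟨∂_r u, ∂_r Δu⟩) dS`. -/
theorem pohozaev_eps_harmonic {l : ℕ} (Ω : Set E2) (hΩ : IsOpen Ω)
    (hball : Metric.closedBall (0 : E2) 1 ⊆ Ω)
    (ε : ℝ) (hε : 0 ≤ ε) (u : E2 → Eu l) (hu : ContDiffOn ℝ (⊤ : ℕ∞) u Ω)
    (hsph : ∀ x ∈ Ω, ‖u x‖ = 1) (hharm : IsEpsHarmonic ε Ω u)
    (t : ℝ) (ht : t ∈ Set.Ioo (0:ℝ) 1) :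
    circInt t (fun x => ‖radialDeriv u x‖ ^ 2 - t⁻¹ ^ 2 * ‖angularDeriv u x‖ ^ 2) =
      (2 * ε / t) * (∫ x in Metric.ball (0 : E2) t, ‖lap u x‖ ^ 2)
        - 2 * ε * circInt t (fun x =>
            (1 / 2) * ‖lap u x‖ ^ 2 + (∑ i : Fin 2, ⟪pd i u x, pd i (lap u) x⟫)
              - 2 * ⟪radialDeriv u x, radialDeriv (lap u) x⟫) := by
  obtain ⟨ht0, ht1⟩ := ht
  have hsub : closedBall (0 : E2) t ⊆ Ω := (closedBall_subset_closedBall ht1.le).trans hball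
  have hdiv := integral_ball_divergence hΩ ht0 hsub
    ((contDiffOn_stressA hΩ hu ε).of_le (by norm_cast))
    ((contDiffOn_stressB hΩ hu ε).of_le (by norm_cast))
  rw [setIntegral_congr_fun measurableSet_ball fun x hx =>
    stress_divergence hΩ hu hsph hharm (hsub (ball_subset_closedBall hx)),
    integral_const_mul] at hdiv
  have hv := hu.lap_infty hΩ
  have cu := fun i => continuous_comp_polarPt ht0.le hsub (hu.pd_infty hΩ i).continuousOn
  have cv := continuous_comp_polarPt ht0.le hsub hv.continuousOn
  have cw := fun i => continuous_comp_polarPt ht0.le hsub (hv.pd_infty hΩ i).continuousOn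
  have cru : Continuous fun θ => radialDeriv u (polarPt (t, θ)) := by
    simp only [radialDeriv_polarPt _ ht0]
    exact (Real.continuous_cos.smul (cu 0)).add (Real.continuous_sin.smul (cu 1))
  have crv : Continuous fun θ => radialDeriv (lap u) (polarPt (t, θ)) := by
    simp only [radialDeriv_polarPt _ ht0]
    exact (Real.continuous_cos.smul (cw 0)).add (Real.continuous_sin.smul (cw 1))
  have cau : Continuous fun θ => angularDeriv u (polarPt (t, θ)) := by
    simp only [angularDeriv_polarPt]
    exact ((continuous_const.mul Real.continuous_sin).neg.smul (cu 0)).add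
      ((continuous_const.mul Real.continuous_cos).smul (cu 1))
  have hL : Continuous fun θ => (‖radialDeriv u (polarPt (t, θ))‖ ^ 2 -
      t⁻¹ ^ 2 * ‖angularDeriv u (polarPt (t, θ))‖ ^ 2) * t :=
    ((cru.norm.pow 2).sub (continuous_const.mul (cau.norm.pow 2))).mul continuous_const
  have hG : Continuous fun θ => ((1 / 2) * ‖lap u (polarPt (t, θ))‖ ^ 2 +
      (∑ i : Fin 2, ⟪pd i u (polarPt (t, θ)), pd i (lap u) (polarPt (t, θ))⟫) -
        2 * ⟪radialDeriv u (polarPt (t, θ)), radialDeriv (lap u) (polarPt (t, θ))⟫) * t :=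
    (((continuous_const.mul (cv.norm.pow 2)).add
      (continuous_finsetSum _ fun i _ => (cu i).inner (cw i))).sub
        (continuous_const.mul (cru.inner crv))).mul continuous_const
  have hsum : circInt t (fun x => (x 0 * stressA ε u x + x 1 * stressB ε u x) / t) =
      -(t / 2) * (circInt t (fun x => ‖radialDeriv u x‖ ^ 2 - t⁻¹ ^ 2 * ‖angularDeriv u x‖ ^ 2) +
        2 * ε * circInt t (fun x =>
            (1 / 2) * ‖lap u x‖ ^ 2 + (∑ i : Fin 2, ⟪pd i u x, pd i (lap u) x⟫)
              - 2 * ⟪radialDeriv u x, radialDeriv (lap u) x⟫)) := by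
    simp only [circInt_eq_polarPt]
    rw [← intervalIntegral.integral_const_mul (2 * ε), ← intervalIntegral.integral_add
      (hL.intervalIntegrable _ _) ((hG.intervalIntegrable _ _).const_mul (2 * ε)),
      ← intervalIntegral.integral_const_mul]
    refine intervalIntegral.integral_congr fun θ _ => ?_
    simp only [stress_normal ε u ht0 (θ := θ) rfl]
    ring
  rw [hsum] at hdiv
  generalize circInt t _ = L at hdiv ⊢
  generalize circInt t _ = G at hdiv ⊢
  field_simp
  linear_combination 2 * hdiv

end
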